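/- arXiv:2502.03867 — 3 statements merged into one kernel-verified Lean document; each statement's English description precedes it below -/
import Mathlib

section
/- Let X be a real Hilbert space and {C_i}_{i=1}^m a family of nonempty, closed and convex subsets of X with nonempty intersection C, satisfying the bounded regularity condition. Fix Δ ∈ (0, 1/m) and an integer q̄ ≥ m. Let {β_k}_{k=0}^∞ be a sequence of non-negative reals with Σ_{k=0}^∞ β_k < ∞, let {v^k}_{k=0}^∞ ⊆ X be a norm-bounded sequence, and let (Ω_k, w_k) ∈ M_*(Δ, q̄) for all k ≥ 0. Then any sequence {y^k}_{k=0}^∞ generated by y^{k+1} := P_{Ω_k, w_k}(y^k + β_k v^k) converges in the norm of X, and its limit belongs to C. -/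
open scoped RealInnerProductSpace

/-- The string operator `P[t] := P_{t_q} ∘ ⋯ ∘ P_{t_1}` : the composition of the
projections indexed by the entries of the index vector `t`, applied in order. -/
def stringOp {X : Type*} {m : ℕ} (P : Fin m → X → X) (t : List (Fin m)) (x : X) : X :=
  t.foldl (fun y i => P i y) x

/-- The string-averaging operator `P_{Ω,w}(x) := Σ_{t ∈ Ω} w(t) • P[t](x)`. -/
noncomputable def strAvg {X : Type*} [NormedAddCommGroup X] [InnerProductSpace ℝ X] {m : ℕ}
    (P : Fin m → X → X) (Ω : Finset (List (Fin m))) (w : List (Fin m) → ℝ) (x : X) : X :=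
  ∑ t ∈ Ω, w t • stringOp P t x

theorem aux_proj {X : Type*} [NormedAddCommGroup X] [InnerProductSpace ℝ X]
    (K : Set X) (hK : Convex ℝ K) (x p c : X) (hp : p ∈ K) (hmin : ∀ c ∈ K, ‖x - p‖ ≤ ‖x - c‖)
    (hc : c ∈ K) : ‖x - p‖ ^ 2 + ‖p - c‖ ^ 2 ≤ ‖x - c‖ ^ 2 := by
  have h1 : ‖x - p‖ = ⨅ z : K, ‖x - z‖ := by
    have : Nonempty K := ⟨⟨p, hp⟩⟩
    apply le_antisymm
    · exact le_ciInf fun z => hmin z z.2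
    · exact ciInf_le ⟨0, by rintro _ ⟨z, rfl⟩; exact norm_nonneg _⟩ (⟨p, hp⟩ : K)
  have h2 := (norm_eq_iInf_iff_real_inner_le_zero hK hp).1 h1 c hc
  have h3 : x - c = (x - p) - (c - p) := by abel
  have h4 : ‖p - c‖ = ‖c - p‖ := norm_sub_rev _ _
  have h5 := norm_sub_sq_real (x - p) (c - p)
  rw [h3, h4, h5]
  linarith

theorem aux_string {X : Type*} [NormedAddCommGroup X] [InnerProductSpace ℝ X]
    {m : ℕ} (C : Fin m → Set X) (hCcv : ∀ i, Convex ℝ (C i))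
    (P : Fin m → X → X)
    (hP : ∀ i x, P i x ∈ C i ∧ ∀ c ∈ C i, ‖x - P i x‖ ≤ ‖x - c‖)
    (c : X) (hc : ∀ i, c ∈ C i) (t : List (Fin m)) :
    ∀ x, ‖stringOp P t x - c‖ ^ 2 ≤ ‖x - c‖ ^ 2 ∧ ∀ i ∈ t,
      (Metric.infDist x (C i)) ^ 2 ≤
        2 ^ t.length * (‖x - c‖ ^ 2 - ‖stringOp P t x - c‖ ^ 2) := by
  induction t with
  | nil => intro x; simp [stringOp]
  | cons a t ih =>
    intro x
    have e : stringOp P (a :: t) x = stringOp P t (P a x) := rfl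
    rw [e]
    obtain ⟨h1, h2⟩ := ih (P a x)
    have h3 := aux_proj (C a) (hCcv a) x (P a x) c (hP a x).1 (hP a x).2 (hc a)
    have hx : Metric.infDist x (C a) ≤ ‖x - P a x‖ := by
      rw [← dist_eq_norm]; exact Metric.infDist_le_dist_of_mem (hP a x).1
    have hpow : (1 : ℝ) ≤ 2 ^ t.length := one_le_pow₀ (by norm_num)
    refine ⟨by nlinarith [sq_nonneg ‖x - P a x‖], ?_⟩
    intro i hi
    rw [List.length_cons, pow_succ (2 : ℝ)]
    rcases List.mem_cons.1 hi with rfl | hi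
    · have h0 : (Metric.infDist x (C i)) ^ 2 ≤ ‖x - P i x‖ ^ 2 :=
        pow_le_pow_left₀ Metric.infDist_nonneg hx 2
      nlinarith [sq_nonneg ‖x - P i x‖]
    · have h4 := h2 i hi
      have h5 : Metric.infDist x (C i) ≤ ‖x - P a x‖ + Metric.infDist (P a x) (C i) := by
        have := Metric.infDist_le_infDist_add_dist (s := C i) (x := x) (y := P a x)
        rw [dist_eq_norm] at this; linarith
      have h6 : (Metric.infDist x (C i)) ^ 2 ≤
          2 * ‖x - P a x‖ ^ 2 + 2 * (Metric.infDist (P a x) (C i)) ^ 2 := by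
        have := pow_le_pow_left₀ Metric.infDist_nonneg h5 2
        nlinarith [sq_nonneg (‖x - P a x‖ - Metric.infDist (P a x) (C i))]
      have h7 : ‖x - P a x‖ ^ 2 ≤ 2 ^ t.length * (‖x - c‖ ^ 2 - ‖P a x - c‖ ^ 2) := by
        nlinarith [sq_nonneg ‖x - P a x‖]
      linarith

theorem aux_avg {X : Type*} [NormedAddCommGroup X] [InnerProductSpace ℝ X]
    {m : ℕ} (C : Fin m → Set X) (hCcv : ∀ i, Convex ℝ (C i))
    (P : Fin m → X → X)
    (hP : ∀ i x, P i x ∈ C i ∧ ∀ c ∈ C i, ‖x - P i x‖ ≤ ‖x - c‖)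
    (c : X) (hc : ∀ i, c ∈ C i) (Δ : ℝ) (hΔ0 : 0 < Δ) (qbar : ℕ)
    (Ω : Finset (List (Fin m))) (w : List (Fin m) → ℝ)
    (hfit : ∀ i : Fin m, ∃ t ∈ Ω, i ∈ t)
    (hlen : ∀ t ∈ Ω, t.length ≤ qbar)
    (hwΔ : ∀ t ∈ Ω, Δ ≤ w t)
    (hwsum : ∑ t ∈ Ω, w t = 1) (x : X) :
    ‖strAvg P Ω w x - c‖ ^ 2 ≤ ‖x - c‖ ^ 2 ∧ ∀ i,
      Δ * (Metric.infDist x (C i)) ^ 2 ≤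
        2 ^ qbar * (‖x - c‖ ^ 2 - ‖strAvg P Ω w x - c‖ ^ 2) := by
  have hS := fun t => aux_string C hCcv P hP c hc t x
  have hw0 : ∀ t ∈ Ω, 0 ≤ w t := fun t ht => hΔ0.le.trans (hwΔ t ht)
  have e : strAvg P Ω w x - c = ∑ t ∈ Ω, w t • (stringOp P t x - c) := by
    simp only [smul_sub, Finset.sum_sub_distrib, ← Finset.sum_smul, hwsum, one_smul, strAvg]
  have h1 : ‖strAvg P Ω w x - c‖ ^ 2 ≤ ∑ t ∈ Ω, w t * ‖stringOp P t x - c‖ ^ 2 := by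
    have hcv : ConvexOn ℝ Set.univ (fun z : X => ‖z‖ ^ 2) :=
      (convexOn_norm convex_univ).pow (fun _ _ => norm_nonneg _) 2
    have := hcv.map_sum_le (t := Ω) (w := w) (p := fun t => stringOp P t x - c) hw0 hwsum
      (fun _ _ => Set.mem_univ _)
    rw [e]
    simpa using this
  have h2 : ‖x - c‖ ^ 2 - ∑ t ∈ Ω, w t * ‖stringOp P t x - c‖ ^ 2 =
      ∑ t ∈ Ω, w t * (‖x - c‖ ^ 2 - ‖stringOp P t x - c‖ ^ 2) := by
    simp only [mul_sub, Finset.sum_sub_distrib, ← Finset.sum_mul, hwsum, one_mul]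
  have h3 : ∀ t ∈ Ω, 0 ≤ w t * (‖x - c‖ ^ 2 - ‖stringOp P t x - c‖ ^ 2) := fun t ht =>
    mul_nonneg (hw0 t ht) (sub_nonneg.2 (hS t).1)
  refine ⟨by linarith [Finset.sum_nonneg h3], ?_⟩
  intro i
  obtain ⟨t, ht, hit⟩ := hfit i
  have h4 := Finset.single_le_sum h3 ht
  have h5 := (hS t).2 i hit
  have h6 : (0 : ℝ) ≤ ‖x - c‖ ^ 2 - ‖stringOp P t x - c‖ ^ 2 := sub_nonneg.2 (hS t).1
  have h7 : (2 : ℝ) ^ t.length ≤ 2 ^ qbar := pow_le_pow_right₀ (by norm_num) (hlen t ht)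
  calc Δ * (Metric.infDist x (C i)) ^ 2
      ≤ Δ * (2 ^ qbar * (‖x - c‖ ^ 2 - ‖stringOp P t x - c‖ ^ 2)) := by
        gcongr
        exact h5.trans (mul_le_mul_of_nonneg_right h7 h6)
    _ = 2 ^ qbar * (Δ * (‖x - c‖ ^ 2 - ‖stringOp P t x - c‖ ^ 2)) := by ring
    _ ≤ 2 ^ qbar * (w t * (‖x - c‖ ^ 2 - ‖stringOp P t x - c‖ ^ 2)) := by
        gcongr
        exact hwΔ t ht
    _ ≤ _ := by
        gcongr
        linarith

theorem stmt_1
    {X : Type*} [NormedAddCommGroup X] [InnerProductSpace ℝ X] [CompleteSpace X]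
    {m : ℕ} (hm : 0 < m) (C : Fin m → Set X)
    (hCne : ∀ i, (C i).Nonempty) (hCcl : ∀ i, IsClosed (C i)) (hCcv : ∀ i, Convex ℝ (C i))
    (hCint : (⋂ i, C i).Nonempty)
    -- bounded regularity condition
    (hreg : ∀ ε > (0 : ℝ), ∀ M > (0 : ℝ), ∃ δ > (0 : ℝ), ∀ x : X, ‖x‖ < M →
      (∀ i, Metric.infDist x (C i) < δ) → Metric.infDist x (⋂ i, C i) < ε)
    -- `P i` is the metric projection onto `C i`
    (P : Fin m → X → X)
    (hP : ∀ i x, P i x ∈ C i ∧ ∀ c ∈ C i, ‖x - P i x‖ ≤ ‖x - c‖)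
    -- parameters of the class `M_*(Δ, q̄)`
    (Δ : ℝ) (hΔ0 : 0 < Δ) (hΔm : Δ < 1 / (m : ℝ)) (qbar : ℕ) (hqbar : m ≤ qbar)
    -- the pairs (Ω_k, w_k) ∈ M_*(Δ, q̄): nonempty index vectors, fit,
    -- lengths bounded by q̄, weights bounded below by Δ and summing to one
    (Ω : ℕ → Finset (List (Fin m))) (w : ℕ → List (Fin m) → ℝ)
    (hΩne : ∀ k, ∀ t ∈ Ω k, t ≠ [])
    (hfit : ∀ k, ∀ i : Fin m, ∃ t ∈ Ω k, i ∈ t)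
    (hlen : ∀ k, ∀ t ∈ Ω k, t.length ≤ qbar)
    (hwΔ : ∀ k, ∀ t ∈ Ω k, Δ ≤ w k t)
    (hwsum : ∀ k, ∑ t ∈ Ω k, w k t = 1)
    -- summable nonnegative step-sizes and a norm-bounded sequence of directions
    (β : ℕ → ℝ) (hβ : ∀ k, 0 ≤ β k) (hβsum : Summable β)
    (v : ℕ → X) (hv : ∃ M : ℝ, ∀ k, ‖v k‖ ≤ M)
    -- the perturbed DSAP iteration
    (y : ℕ → X) (hy : ∀ k, y (k + 1) = strAvg P (Ω k) (w k) (y k + β k • v k)) :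
    ∃ ystar ∈ ⋂ i, C i, Filter.Tendsto y Filter.atTop (nhds ystar) := by
  obtain ⟨M, hM⟩ := hv
  have hM0 : 0 ≤ M := (norm_nonneg _).trans (hM 0)
  have key := fun (c : X) (hc : ∀ i, c ∈ C i) (k : ℕ) =>
    aux_avg C hCcv P hP c hc Δ hΔ0 qbar (Ω k) (w k) (hfit k) (hlen k) (hwΔ k) (hwsum k)
      (y k + β k • v k)
  simp only [← hy] at key
  set S : ℕ → ℝ := fun k => ∑ j ∈ Finset.range k, β j with hS
  have hSlim : Filter.Tendsto S Filter.atTop (nhds (∑' j, β j)) := hβsum.hasSum.tendsto_sum_nat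
  have hSle : ∀ k, S k ≤ ∑' j, β j := fun k => hβsum.sum_le_tsum _ (fun j _ => hβ j)
  have hSs : ∀ k, S (k + 1) = S k + β k := fun k => Finset.sum_range_succ _ _
  have hxy : ∀ k, ‖β k • v k‖ ≤ M * β k := by
    intro k
    rw [norm_smul, Real.norm_of_nonneg (hβ k), mul_comm]
    exact mul_le_mul_of_nonneg_right (hM k) (hβ k)
  have hxc : ∀ c k, ‖y k + β k • v k - c‖ ≤ ‖y k - c‖ + M * β k := by
    intro c k
    have : y k + β k • v k - c = (y k - c) + β k • v k := by abel
    rw [this]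
    exact (norm_add_le _ _).trans (by linarith [hxy k])
  have hanti : ∀ c, (∀ i, c ∈ C i) → Antitone (fun k => ‖y k - c‖ - M * S k) := by
    intro c hc
    apply antitone_nat_of_succ_le
    intro k
    have h1 := (key c hc k).1
    have h2 := le_of_sq_le_sq h1 (norm_nonneg _)
    have h3 := hxc c k
    rw [hSs]
    linarith
  obtain ⟨c, hcC⟩ := hCint
  have hc : ∀ i, c ∈ C i := Set.mem_iInter.1 hcC
  have hbase : ∃ L, Filter.Tendsto (fun k => ‖y k - c‖) Filter.atTop (nhds L) := by
    have hb : BddBelow (Set.range (fun k => ‖y k - c‖ - M * S k)) := by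
      refine ⟨-(M * ∑' j, β j), ?_⟩
      rintro _ ⟨k, rfl⟩
      have := mul_le_mul_of_nonneg_left (hSle k) hM0
      have := norm_nonneg (y k - c)
      simp only
      linarith
    have h1 := tendsto_atTop_ciInf (hanti c hc) hb
    have h2 := h1.add (hSlim.const_mul M)
    refine ⟨_, h2.congr fun k => ?_⟩
    ring
  obtain ⟨L, hL⟩ := hbase
  have hβ0 : Filter.Tendsto (fun k => M * β k) Filter.atTop (nhds 0) := by
    simpa using hβsum.tendsto_atTop_zero.const_mul M
  have hdecr : Filter.Tendsto (fun k => 2 ^ qbar / Δ * ((‖y k - c‖ + M * β k) ^ 2 -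
      ‖y (k + 1) - c‖ ^ 2)) Filter.atTop (nhds 0) := by
    have h1 := (((hL.add hβ0).pow 2).sub (((Filter.tendsto_add_atTop_iff_nat 1).2 hL).pow 2)).const_mul
      (2 ^ qbar / Δ)
    simpa using h1
  have hdi : ∀ δ > 0, ∀ᶠ k in Filter.atTop, ∀ i,
      Metric.infDist (y k + β k • v k) (C i) < δ := by
    intro δ hδ
    filter_upwards [hdecr.eventually (gt_mem_nhds (show (0 : ℝ) < δ ^ 2 by positivity))] with k hk i
    have h1 := (key c hc k).2 i
    have h2 := pow_le_pow_left₀ (norm_nonneg _) (hxc c k) 2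
    have h3 : (Metric.infDist (y k + β k • v k) (C i)) ^ 2 ≤ 2 ^ qbar / Δ *
        ((‖y k - c‖ + M * β k) ^ 2 - ‖y (k + 1) - c‖ ^ 2) := by
      rw [div_mul_eq_mul_div, le_div_iff₀ hΔ0, mul_comm]
      refine h1.trans ?_
      gcongr
    exact lt_of_pow_lt_pow_left₀ 2 hδ.le (h3.trans_lt hk)
  have hd : ∀ ε > 0, ∀ᶠ k in Filter.atTop, Metric.infDist (y k) (⋂ i, C i) < ε := by
    intro ε hε
    obtain ⟨δ, hδ, H⟩ := hreg (ε / 2) (by positivity) (|L| + 1 + 1 + ‖c‖) (by positivity)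
    filter_upwards [hdi δ hδ, hβ0.eventually (gt_mem_nhds (show (0 : ℝ) < ε / 2 by positivity)),
      hβ0.eventually (gt_mem_nhds (show (0 : ℝ) < 1 by norm_num)),
      hL.eventually (gt_mem_nhds (show L < |L| + 1 by linarith [le_abs_self L]))] with k h1 h2 h3 h4
    have h5 : ‖y k + β k • v k‖ < |L| + 1 + 1 + ‖c‖ := by
      have := hxc c k
      have := norm_le_norm_sub_add (y k + β k • v k) c
      linarith
    have h6 := H _ h5 h1
    have h7 := Metric.infDist_le_infDist_add_dist (s := ⋂ i, C i) (x := y k) (y := y k + β k • v k)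
    have h8 : dist (y k) (y k + β k • v k) ≤ M * β k := by
      rw [dist_self_add_right]; exact hxy k
    linarith
  have hCauchy : CauchySeq y := by
    rw [Metric.cauchySeq_iff']
    intro ε hε
    have hSM : Filter.Tendsto (fun k => M * (∑' j, β j) - M * S k) Filter.atTop (nhds 0) := by
      simpa using (hSlim.const_mul M).const_sub (M * ∑' j, β j)
    obtain ⟨N, h1, h2⟩ := ((hd (ε / 4) (by positivity)).and
      (hSM.eventually (gt_mem_nhds (show (0 : ℝ) < ε / 4 by positivity)))).exists
    obtain ⟨z, hz, hzd⟩ := (Metric.infDist_lt_iff ⟨c, hcC⟩).1 h1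
    refine ⟨N, fun n hn => ?_⟩
    have h3 := hanti z (Set.mem_iInter.1 hz) hn
    simp only at h3
    have h4 := mul_le_mul_of_nonneg_left (hSle n) hM0
    have h5 := dist_triangle_right (y n) (y N) z
    rw [← dist_eq_norm, ← dist_eq_norm] at h3
    linarith
  obtain ⟨z, hz⟩ := cauchySeq_tendsto_of_complete hCauchy
  refine ⟨z, ?_, hz⟩
  have hcl : IsClosed (⋂ i, C i) := isClosed_iInter hCcl
  rw [hcl.mem_iff_infDist_zero ⟨c, hcC⟩]
  have h1 : Filter.Tendsto (fun k => Metric.infDist (y k) (⋂ i, C i)) Filter.atTop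
      (nhds (Metric.infDist z (⋂ i, C i))) :=
    ((Metric.continuous_infDist_pt _).tendsto z).comp hz
  refine le_antisymm (le_of_forall_pos_le_add fun ε hε => ?_) Metric.infDist_nonneg
  rw [zero_add]
  exact le_of_tendsto h1 ((hd ε hε).mono fun k hk => hk.le)
end

section
/- In X = ℝ with φ(x) = x², C = [0,10] and D = {0}, consider the superiorized sequence with step-sizes β_k := 2^{−k} (one perturbation per outer iteration), namely y^{k+1} := P_{[0,10]}(y^k + 2^{−k}·v^k), where v^k = −1 if y^k > 0, v^k = 1 if y^k < 0, v^k = 0 if y^k = 0, and P_{[0,10]} is the metric projection of ℝ onto [0,10]. If the initialization satisfies y^0 ≥ 13, then for every integer k ≥ 1 one has y^k = 10 − Σ_{ℓ=1}^{k−1} 2^{−ℓ} (equivalently y^k = 9 + 2^{1−k}), and consequently y^k converges to 9 as k → ∞; in particular the limit does not belong to D = {0}. -/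
theorem stmt_8
    -- the superiorized sequence in X = ℝ with φ(x) = x², C = [0, 10]:
    -- y^(k+1) = P_[0,10](y^k + 2^(−k)·v^k) with v^k the normalized negative
    -- subgradient direction −sign(y^k) (taken to be 0 when y^k = 0)
    (y : ℕ → ℝ)
    (hy : ∀ k : ℕ, y (k + 1) =
      min (max (y k + (2 : ℝ) ^ (-(k : ℤ)) *
        (if 0 < y k then -1 else if y k < 0 then 1 else 0)) 0) (10 : ℝ))
    -- the initialization satisfies y^0 ≥ 13
    (hy0 : 13 ≤ y 0) :
    (∀ k : ℕ, 1 ≤ k →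
      y k = (10 : ℝ) - ∑ l ∈ Finset.Ico 1 k, (2 : ℝ) ^ (-(l : ℤ)) ∧
      y k = (9 : ℝ) + (2 : ℝ) ^ ((1 : ℤ) - (k : ℤ))) ∧
    Filter.Tendsto y Filter.atTop (nhds (9 : ℝ)) ∧
    (9 : ℝ) ∉ ({0} : Set ℝ) := by
  have hz : ∀ n : ℕ, (2 : ℝ) ^ (-(n : ℤ)) = (1 / 2 : ℝ) ^ n := by
    intro n
    rw [zpow_neg, zpow_natCast, one_div, inv_pow]
  have key : ∀ n : ℕ, y (n + 1) = 9 + (1 / 2 : ℝ) ^ n := by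
    intro n
    induction n with
    | zero =>
      rw [hy 0, hz, if_pos (by linarith), max_eq_left (by norm_num; linarith),
        min_eq_right (by norm_num; linarith)]
      norm_num
    | succ n ih =>
      have h0 : (0 : ℝ) < (1 / 2 : ℝ) ^ n := by positivity
      have h1 : (1 / 2 : ℝ) ^ n ≤ 1 := pow_le_one₀ (by norm_num) (by norm_num)
      have h2 : (1 / 2 : ℝ) ^ (n + 1) = (1 / 2 : ℝ) ^ n / 2 := by rw [pow_succ]; ring
      rw [hy (n + 1), hz, ih, if_pos (by linarith), h2, max_eq_left (by linarith),
        min_eq_left (by linarith)]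
      ring
  have hs : ∀ n : ℕ, (10 : ℝ) - ∑ l ∈ Finset.Ico 1 (n + 1), (2 : ℝ) ^ (-(l : ℤ))
      = 9 + (1 / 2 : ℝ) ^ n := by
    intro n
    induction n with
    | zero => norm_num
    | succ n ih =>
      rw [Finset.sum_Ico_succ_top (by omega), hz, pow_succ]
      linarith
  refine ⟨?_, ?_, by norm_num⟩
  · intro k hk
    obtain ⟨n, rfl⟩ : ∃ n, k = n + 1 := ⟨k - 1, by omega⟩
    refine ⟨by rw [key, hs], ?_⟩
    rw [key, ← hz]
    congr 2
    push_cast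
    ring
  · rw [← Filter.tendsto_add_atTop_iff_nat 1]
    have ht := (tendsto_pow_atTop_nhds_zero_of_lt_one (r := (1 / 2 : ℝ))
      (by norm_num) (by norm_num)).const_add (9 : ℝ)
    rw [add_zero] at ht
    exact ht.congr fun n => (key n).symm
end

section
/- In X = ℝ with φ(x) = x², C = [0, 3/2] and D = {0}, consider the superiorized sequence with step-sizes β_k := 2^{−k} (one perturbation per outer iteration), namely y^{k+1} := P_{[0,3/2]}(y^k + 2^{−k}·v^k), where v^k = −1 if y^k > 0, v^k = 1 if y^k < 0, v^k = 0 if y^k = 0, and P_{[0,3/2]} is the metric projection of ℝ onto [0, 3/2]. If the initialization satisfies y^0 ≥ 13, then for every integer k ≥ 1 one has y^k = 3/2 − Σ_{ℓ=1}^{k−1} 2^{−ℓ} (equivalently y^k = 1/2 + 2^{1−k}), and consequently y^k converges to 1/2 as k → ∞; in particular the limit does not belong to D = {0}. -/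
theorem stmt_9
    -- the superiorized sequence in X = ℝ with φ(x) = x², C = [0, 3 / 2]:
    -- y^(k+1) = P_[0,3 / 2](y^k + 2^(−k)·v^k) with v^k the normalized negative
    -- subgradient direction −sign(y^k) (taken to be 0 when y^k = 0)
    (y : ℕ → ℝ)
    (hy : ∀ k : ℕ, y (k + 1) =
      min (max (y k + (2 : ℝ) ^ (-(k : ℤ)) *
        (if 0 < y k then -1 else if y k < 0 then 1 else 0)) 0) (3 / 2 : ℝ))
    -- the initialization satisfies y^0 ≥ 13
    (hy0 : 13 ≤ y 0) :
    (∀ k : ℕ, 1 ≤ k →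
      y k = (3 / 2 : ℝ) - ∑ l ∈ Finset.Ico 1 k, (2 : ℝ) ^ (-(l : ℤ)) ∧
      y k = (1 / 2 : ℝ) + (2 : ℝ) ^ ((1 : ℤ) - (k : ℤ))) ∧
    Filter.Tendsto y Filter.atTop (nhds (1 / 2 : ℝ)) ∧
    (1 / 2 : ℝ) ∉ ({0} : Set ℝ) := by
  have e1 : ∀ k : ℕ, (2 : ℝ) ^ (-(k : ℤ)) = (1 / 2 : ℝ) ^ k := by
    intro k
    rw [zpow_neg, zpow_natCast, one_div, inv_pow]
  have e2 : ∀ k : ℕ, (2 : ℝ) ^ ((1 : ℤ) - (k : ℤ)) = 2 * (1 / 2 : ℝ) ^ k := by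
    intro k
    rw [sub_eq_add_neg, zpow_add₀ (by norm_num), e1, zpow_one]
  have main : ∀ k : ℕ, 1 ≤ k →
      y k = (3 / 2 : ℝ) - ∑ l ∈ Finset.Ico 1 k, (2 : ℝ) ^ (-(l : ℤ)) ∧
      y k = (1 / 2 : ℝ) + (2 : ℝ) ^ ((1 : ℤ) - (k : ℤ)) := by
    intro k hk
    induction k, hk using Nat.le_induction with
    | base =>
      have h1 : y 1 = 3 / 2 := by
        have h := hy 0
        rw [if_pos (by linarith), e1, zero_add, pow_zero] at h
        rw [h, max_eq_left (by linarith), min_eq_right (by linarith)]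
      rw [h1]
      norm_num
    | succ k hk ih =>
      obtain ⟨ha, hb⟩ := ih
      have hp : (0 : ℝ) < (1 / 2 : ℝ) ^ k := by positivity
      have hq : (1 / 2 : ℝ) ^ k ≤ 1 := pow_le_one₀ (by norm_num) (by norm_num)
      have hb2 := hb
      rw [e2] at hb2
      have h := hy k
      rw [if_pos (by linarith), e1, max_eq_left (by linarith),
        min_eq_left (by linarith)] at h
      constructor
      · rw [Finset.sum_Ico_succ_top hk, e1 k]
        linarith
      · rw [e2, pow_succ]
        linarith
  refine ⟨main, ?_, by norm_num⟩
  have ht : Filter.Tendsto (fun k : ℕ => (1 / 2 : ℝ) + 2 * (1 / 2 : ℝ) ^ k)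
      Filter.atTop (nhds (1 / 2 : ℝ)) := by
    have h := ((tendsto_pow_atTop_nhds_zero_of_lt_one (r := (1 / 2 : ℝ))
      (by norm_num) (by norm_num)).const_mul 2).const_add (1 / 2 : ℝ)
    simpa using h
  refine ht.congr' ?_
  filter_upwards [Filter.eventually_ge_atTop 1] with k hk
  rw [(main k hk).2, e2]
end
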